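/- arXiv:2001.00327 — 2 statements merged into one kernel-verified Lean document; each statement's English description precedes it below -/
import Mathlib

section
/- Let n ≥ 1, let k > ℓ ≥ 1 be integers, and let p be a prime with p ∣ n and p ∣ (k - ℓ). Set δ = gcd(n, k-ℓ) and let r be the remainder of -k·⌊(n + 2(p-1))/(k+ℓ)⌋ + (p-1) modulo δ. Then (as integers) ⌊(n + 2(p-1) - r)/(k+ℓ)⌋ - (p-1) ≤ μ^{{0,p}}_{k,ℓ}(ZMod n) ≤ ⌊n/(k+ℓ)⌋, where {0,p} is the image of {0, p} ⊆ ℤ in ZMod n. -/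
open Finset Pointwise

/-- The `k`-fold Minkowski sum `kA = A + ⋯ + A` (with `0A = {0}`). -/
def iterSum {n : ℕ} : ℕ → Finset (ZMod n) → Finset (ZMod n)
  | 0, _ => {0}
  | j + 1, A => A + iterSum j A

/-- The noisy `k`-fold sum `k *_C A = kA + (k-1)C`. -/
def noisy {n : ℕ} (C : Finset (ZMod n)) (k : ℕ) (A : Finset (ZMod n)) :
    Finset (ZMod n) :=
  iterSum k A + iterSum (k - 1) C

/-- `A` is `C`-`(k,ℓ)`-sum-free: `(k *_C A) ∩ (ℓ *_C A) = ∅`. -/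
def SumFree {n : ℕ} (C : Finset (ZMod n)) (k l : ℕ) (A : Finset (ZMod n)) : Prop :=
  noisy C k A ∩ noisy C l A = ∅

/-- `μ^C_{k,ℓ}(ZMod n)`: the maximum size of a `C`-`(k,ℓ)`-sum-free subset of `ZMod n`. -/
noncomputable def mu (n : ℕ) (k l : ℕ) (C : Finset (ZMod n)) : ℕ :=
  sSup {m | ∃ A : Finset (ZMod n), SumFree C k l A ∧ A.card = m}

/-- The stabilizer `stab(X) = {g : g + X = X}` of a finite subset of `ZMod n`. -/
def stab {n : ℕ} (X : Finset (ZMod n)) : Set (ZMod n) :=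
  {g | X.image (g + ·) = X}

section Sumset

variable {G : Type*} [AddCommGroup G] [DecidableEq G]

/-- If `A` is stable under all translations by `B - b`, then either `A + B + {0, g}` has at least
`|A| + |B|` elements or `A` is stable under translation by `g`. -/
lemma card_add_card_le_of_stable {A B : Finset G} {b : G} (g : G) (hb : b ∈ B)
    (hstab : ∀ a ∈ A, ∀ y ∈ B, a - b + y ∈ A) :
    #A + #B ≤ #(A + B + {0, g}) ∨ ∀ a ∈ A, a + g ∈ A := by
  by_contra! hcon
  obtain ⟨hcard, x, hx, hxg⟩ := hcon
  have hsurj : ∀ y ∈ B, ∀ z ∈ A, ∃ w ∈ A, w - b + y = z := by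
    intro y hy z hz
    obtain ⟨w, hw, hwz⟩ := Finset.surj_on_of_inj_on_of_card_le (fun w _ => w - b + y)
      (fun w hw => hstab w hw y hy) (fun _ _ _ _ h => by simpa using h) le_rfl z hz
    exact ⟨w, hw, hwz.symm⟩
  have hdisj : Disjoint (A.image (· + b)) (B.image (x + g + ·)) := by
    rw [Finset.disjoint_left]
    rintro _ h₁ h₂
    obtain ⟨z, hz, rfl⟩ := Finset.mem_image.1 h₁
    obtain ⟨y, hy, hyz⟩ := Finset.mem_image.1 h₂
    obtain ⟨w, hw, rfl⟩ := hsurj y hy z hz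
    have : x + g = w := by
      have h : x + g + y = w + y := by rw [hyz]; abel
      exact add_right_cancel h
    exact hxg (this ▸ hw)
  have hsub : A.image (· + b) ∪ B.image (x + g + ·) ⊆ A + B + {0, g} := by
    refine Finset.union_subset ?_ ?_ <;> intro z hz <;> obtain ⟨w, hw, rfl⟩ := Finset.mem_image.1 hz
    · exact Finset.mem_add.2 ⟨w + b, Finset.add_mem_add hw hb, 0, by simp, by simp⟩
    · exact Finset.mem_add.2 ⟨x + w, Finset.add_mem_add hx hw, g, by simp, by abel⟩
  have := Finset.card_le_card hsub
  rw [Finset.card_union_of_disjoint hdisj, Finset.card_image_of_injective _ (add_left_injective b),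
    Finset.card_image_of_injective _ (add_right_injective (x + g))] at this
  omega

lemma card_add_card_le_or_add_mem {A B : Finset G} {a b : G} (g : G) (ha : a ∈ A) (hb : b ∈ B) :
    #A + #B ≤ #(A + B + {0, g}) ∨ a + b + g ∈ A + B := by
  induction hN : #B using Nat.strong_induction_on generalizing A B with
  | _ N ih =>
    subst hN
    by_cases hstab : ∀ c ∈ A, ∀ y ∈ B, c - b + y ∈ A
    · refine (card_add_card_le_of_stable g hb hstab).imp_right fun h => ?_
      rw [add_right_comm]
      exact Finset.add_mem_add (h a ha) hb
    · push Not at hstab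
      obtain ⟨c, hc, y, hy, hcy⟩ := hstab
      set A' := A ∪ B.image (c - b + ·) with hA'
      set B' := B.filter (c - b + · ∈ A) with hB'
      have hlt : #B' < #B :=
        Finset.card_lt_card (Finset.filter_ssubset.2 ⟨y, hy, hcy⟩)
      have hsum : #A' + #B' = #A + #B := by
        have h := Finset.card_union_add_card_inter A (B.image (c - b + ·))
        have hinter : A ∩ B.image (c - b + ·) = B'.image (c - b + ·) := by
          ext z
          simp only [hB', Finset.mem_inter, Finset.mem_image, Finset.mem_filter]
          constructor
          · rintro ⟨hz, w, hw, rfl⟩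
            exact ⟨w, ⟨hw, hz⟩, rfl⟩
          · rintro ⟨w, ⟨hw, hz⟩, rfl⟩
            exact ⟨hz, w, hw, rfl⟩
        rwa [hinter, Finset.card_image_of_injective _ (add_right_injective (c - b)),
          Finset.card_image_of_injective _ (add_right_injective (c - b))] at h
      have hsub : A' + B' ⊆ A + B := by
        intro z hz
        obtain ⟨u, hu, v, hv, rfl⟩ := Finset.mem_add.1 hz
        rw [hB', Finset.mem_filter] at hv
        rcases Finset.mem_union.1 hu with hu | hu
        · exact Finset.add_mem_add hu hv.1
        · obtain ⟨w, hw, rfl⟩ := Finset.mem_image.1 hu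
          rw [add_right_comm]
          exact Finset.add_mem_add hv.2 hw
      have hbB' : b ∈ B' := Finset.mem_filter.2 ⟨hb, by simpa using hc⟩
      rcases ih _ hlt (Finset.mem_union_left _ ha) hbB' rfl with h | h
      · left
        rw [← hsum]
        exact h.trans (Finset.card_le_card (Finset.add_subset_add_right hsub))
      · exact Or.inr (hsub h)

lemma card_add_card_le_or_stable (A B : Finset G) (g : G) :
    #A + #B ≤ #(A + B + {0, g}) ∨ ∀ x ∈ A + B + {0, g}, x + g ∈ A + B + {0, g} := by
  by_contra! hcon
  obtain ⟨hcard, x, hx, hxg⟩ := hcon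
  obtain ⟨s, hs, t, ht, rfl⟩ := Finset.mem_add.1 hx
  have hsg : s + g ∈ A + B := by
    obtain ⟨a, ha, b, hb, rfl⟩ := Finset.mem_add.1 hs
    exact (card_add_card_le_or_add_mem g ha hb).resolve_left (by omega)
  exact hxg (by rw [add_right_comm s t g]; exact Finset.add_mem_add hsg ht)

end Sumset

section Noisy

variable {n : ℕ}

lemma nsmul_mem_iterSum {A : Finset (ZMod n)} {a : ZMod n} (ha : a ∈ A) (k : ℕ) :
    k • a ∈ iterSum k A := by
  induction k with
  | zero => simp [iterSum]
  | succ k ih =>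
    rw [succ_nsmul', iterSum]
    exact Finset.add_mem_add ha ih

lemma nsmul_mem_noisy {A C : Finset (ZMod n)} {a : ZMod n} (ha : a ∈ A) (hC : 0 ∈ C) (k : ℕ) :
    k • a ∈ noisy C k A := by
  have h := Finset.add_mem_add (nsmul_mem_iterSum ha k) (nsmul_mem_iterSum hC (k - 1))
  simpa [noisy] using h

lemma noisy_succ (C A : Finset (ZMod n)) {k : ℕ} (hk : 1 ≤ k) :
    noisy C (k + 1) A = noisy C k A + A + C := by
  obtain ⟨k, rfl⟩ := Nat.exists_eq_add_of_le' hk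
  simp only [noisy, Nat.add_sub_cancel]
  rw [iterSum.eq_2 A (k + 1), iterSum.eq_2 C k]
  abel

lemma mul_card_le_card_noisy_or_stable (A : Finset (ZMod n)) (g : ZMod n) {k : ℕ} (hk : 1 ≤ k) :
    k * #A ≤ #(noisy {0, g} k A) ∨ ∀ x ∈ noisy {0, g} k A, x + g ∈ noisy {0, g} k A := by
  induction k, hk using Nat.le_induction with
  | base => left; simp [noisy, iterSum]
  | succ k hk ih =>
    rw [noisy_succ _ _ hk]
    rcases ih with ih | ih
    · refine (card_add_card_le_or_stable (noisy {0, g} k A) A g).imp_left fun h => ?_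
      rw [add_one_mul]
      omega
    · right
      intro x hx
      rw [add_assoc] at hx ⊢
      obtain ⟨s, hs, t, ht, rfl⟩ := Finset.mem_add.1 hx
      rw [add_right_comm]
      exact Finset.add_mem_add (ih s hs) ht

lemma add_nsmul_mem_of_stable {X : Finset (ZMod n)} {g : ZMod n} (hX : ∀ x ∈ X, x + g ∈ X)
    {x : ZMod n} (hx : x ∈ X) (m : ℕ) : x + m • g ∈ X := by
  induction m with
  | zero => simpa using hx
  | succ m ih =>
    rw [succ_nsmul, ← add_assoc]
    exact hX _ ih

lemma add_mul_mem_of_stable [NeZero n] {X : Finset (ZMod n)} {g : ZMod n}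
    (hX : ∀ x ∈ X, x + g ∈ X) {x : ZMod n} (hx : x ∈ X) (c : ZMod n) : x + c * g ∈ X := by
  have h := add_nsmul_mem_of_stable hX hx c.val
  rwa [nsmul_eq_mul, ZMod.natCast_zmod_val] at h

lemma SumFree.add_mul_card_le [NeZero n] {k l p : ℕ} {A : Finset (ZMod n)} (hk : 1 ≤ k)
    (hl : 1 ≤ l) (hp : (p : ℤ) ∣ (k : ℤ) - l) (hA : SumFree {0, (p : ZMod n)} k l A) :
    (k + l) * #A ≤ n := by
  rcases A.eq_empty_or_nonempty with rfl | ⟨a, ha⟩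
  · simp
  have hdisj : Disjoint (noisy {0, (p : ZMod n)} k A) (noisy {0, (p : ZMod n)} l A) :=
    Finset.disjoint_iff_inter_eq_empty.2 hA
  have hka := nsmul_mem_noisy (C := {0, (p : ZMod n)}) ha (by simp) k
  have hla := nsmul_mem_noisy (C := {0, (p : ZMod n)}) ha (by simp) l
  obtain ⟨q, hq⟩ := hp
  have hkl : (k : ZMod n) - l = p * q := by exact_mod_cast congrArg (Int.cast : ℤ → ZMod n) hq
  have hk' := (mul_card_le_card_noisy_or_stable A (p : ZMod n) hk).resolve_right fun h => by
    refine Finset.disjoint_left.1 hdisj ?_ hla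
    convert add_mul_mem_of_stable h hka (-(q * a)) using 1
    rw [nsmul_eq_mul, nsmul_eq_mul]
    linear_combination -a * hkl
  have hl' := (mul_card_le_card_noisy_or_stable A (p : ZMod n) hl).resolve_right fun h => by
    refine Finset.disjoint_left.1 hdisj hka ?_
    convert add_mul_mem_of_stable h hla (q * a) using 1
    rw [nsmul_eq_mul, nsmul_eq_mul]
    linear_combination a * hkl
  have hcard := Finset.card_le_univ (noisy {0, (p : ZMod n)} k A ∪ noisy {0, (p : ZMod n)} l A)
  rw [Finset.card_union_of_disjoint hdisj, ZMod.card] at hcard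
  rw [add_mul]
  omega

lemma exists_intCast_of_mem_iterSum {A : Finset (ZMod n)} {a b : ℤ}
    (hA : ∀ x ∈ A, ∃ i : ℤ, a ≤ i ∧ i ≤ b ∧ (i : ZMod n) = x) (k : ℕ) :
    ∀ x ∈ iterSum k A, ∃ i : ℤ, k * a ≤ i ∧ i ≤ k * b ∧ (i : ZMod n) = x := by
  induction k with
  | zero =>
    intro x hx
    exact ⟨0, by simp, by simp, by simpa [iterSum, eq_comm] using hx⟩
  | succ k ih =>
    intro x hx
    obtain ⟨u, hu, v, hv, rfl⟩ := Finset.mem_add.1 hx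
    obtain ⟨i, hi₁, hi₂, rfl⟩ := hA u hu
    obtain ⟨j, hj₁, hj₂, rfl⟩ := ih v hv
    exact ⟨i + j, by push_cast; linarith, by push_cast; linarith, by push_cast; rfl⟩

lemma exists_intCast_of_mem_noisy {A : Finset (ZMod n)} {a b : ℤ} {p k : ℕ} (hk : 1 ≤ k)
    (hA : ∀ x ∈ A, ∃ i : ℤ, a ≤ i ∧ i ≤ b ∧ (i : ZMod n) = x) :
    ∀ x ∈ noisy {0, (p : ZMod n)} k A,
      ∃ i : ℤ, k * a ≤ i ∧ i ≤ k * b + (k - 1) * p ∧ (i : ZMod n) = x := by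
  intro x hx
  obtain ⟨u, hu, v, hv, rfl⟩ := Finset.mem_add.1 hx
  obtain ⟨i, hi₁, hi₂, rfl⟩ := exists_intCast_of_mem_iterSum hA k u hu
  have hC : ∀ x ∈ ({0, (p : ZMod n)} : Finset (ZMod n)),
      ∃ i : ℤ, 0 ≤ i ∧ i ≤ p ∧ (i : ZMod n) = x := by
    simp only [Finset.mem_insert, Finset.mem_singleton, forall_eq_or_imp, forall_eq]
    exact ⟨⟨0, by simp⟩, ⟨p, by simp⟩⟩
  obtain ⟨j, hj₁, hj₂, rfl⟩ := exists_intCast_of_mem_iterSum hC (k - 1) v hv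
  rw [Nat.cast_sub hk, Nat.cast_one] at hj₂
  exact ⟨i + j, by linarith, by linarith, by push_cast; rfl⟩

/-- The interval `[a, a + s)` is sum-free as soon as `(k - l) * a` is congruent modulo `n` to some
`t` which separates the two intervals containing the noisy sums. -/
lemma sumFree_image_Ico {k l p : ℕ} (hk : 1 ≤ k) (hl : 1 ≤ l) {a s t : ℤ}
    (hat : (n : ℤ) ∣ (k - l) * a - t)
    (hlo : l * (s - 1) + (l - 1) * p < t) (hhi : t + k * (s - 1) + (k - 1) * p < n) :
    SumFree {0, (p : ZMod n)} k l ((Finset.Ico a (a + s)).image (Int.cast : ℤ → ZMod n)) := by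
  have hA : ∀ x ∈ (Finset.Ico a (a + s)).image (Int.cast : ℤ → ZMod n),
      ∃ i : ℤ, a ≤ i ∧ i ≤ a + s - 1 ∧ (i : ZMod n) = x := by
    intro x hx
    obtain ⟨i, hi, rfl⟩ := Finset.mem_image.1 hx
    rw [Finset.mem_Ico] at hi
    exact ⟨i, hi.1, by omega, rfl⟩
  refine Finset.disjoint_iff_inter_eq_empty.1 (Finset.disjoint_left.2 fun x hx hy => ?_)
  obtain ⟨i, hi₁, hi₂, rfl⟩ := exists_intCast_of_mem_noisy hk hA x hx
  obtain ⟨j, hj₁, hj₂, hij⟩ := exists_intCast_of_mem_noisy hl hA _ hy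
  have hdvd : (n : ℤ) ∣ i - j := (ZMod.intCast_eq_intCast_iff_dvd_sub j i n).1 hij
  have hdvd' : (n : ℤ) ∣ i - j - ((k - l) * a - t) := dvd_sub hdvd hat
  have hpos : 0 < i - j - ((k - l) * a - t) := by linarith
  have := Int.le_of_dvd hpos hdvd'
  linarith

lemma card_image_intCast_Ico {a s : ℤ} (hs : 0 ≤ s) (hsn : s ≤ n) :
    (#((Finset.Ico a (a + s)).image (Int.cast : ℤ → ZMod n)) : ℤ) = s := by
  rw [Finset.card_image_of_injOn, Int.card_Ico]
  · rw [add_sub_cancel_left, Int.toNat_of_nonneg hs]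
  · intro i hi j hj hij
    rw [Finset.coe_Ico, Set.mem_Ico] at hi hj
    have hdvd : (n : ℤ) ∣ j - i := (ZMod.intCast_eq_intCast_iff_dvd_sub i j n).1 hij
    have := Int.eq_zero_of_abs_lt_dvd hdvd (abs_lt.2 ⟨by omega, by omega⟩)
    omega

lemma bddAbove_card_sumFree [NeZero n] (k l : ℕ) (C : Finset (ZMod n)) :
    BddAbove {m | ∃ A : Finset (ZMod n), SumFree C k l A ∧ #A = m} := by
  refine ⟨n, ?_⟩
  rintro _ ⟨A, -, rfl⟩
  simpa [ZMod.card] using Finset.card_le_univ A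

lemma SumFree.card_le_mu [NeZero n] {k l : ℕ} {C A : Finset (ZMod n)} (hA : SumFree C k l A) :
    #A ≤ mu n k l C :=
  le_csSup (bddAbove_card_sumFree k l C) ⟨A, hA, rfl⟩

lemma mu_le {k l N : ℕ} {C : Finset (ZMod n)} (h : ∀ A, SumFree C k l A → #A ≤ N) :
    mu n k l C ≤ N := by
  refine csSup_le' ?_
  rintro _ ⟨A, hA, rfl⟩
  exact h A hA

end Noisy

/-- The window `[l * m - e, N - k * m + e]` contains a multiple of `δ`: if `m` is the unreduced
quotient, then the right end has residue `r`, and otherwise the window is longer than `δ`. -/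
lemma exists_multiple_le_of_residue {N k l e δ r m : ℤ} (hδ : 0 < δ) (hδN : δ ∣ N)
    (hδk : δ ≤ k + l) (hkl : 0 < k + l)
    (hr : r = (-k * ((N + 2 * e) / (k + l)) + e) % δ)
    (hm : m = (N + 2 * e - r) / (k + l)) :
    ∃ t : ℤ, δ ∣ t ∧ l * m - e ≤ t ∧ t ≤ N - k * m + e := by
  have hr0 : 0 ≤ r := hr ▸ Int.emod_nonneg _ hδ.ne'
  have hmr : (k + l) * m ≤ N + 2 * e - r := by
    rw [hm]; exact Int.mul_ediv_self_le hkl.ne'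
  set M := (N + 2 * e) / (k + l) with hM
  have hmM : m ≤ M := by
    rw [hm, hM]; exact Int.ediv_le_ediv hkl (by omega)
  have hMle : (k + l) * M ≤ N + 2 * e := Int.mul_ediv_self_le hkl.ne'
  rcases hmM.eq_or_lt with heq | hlt
  · refine ⟨N - k * m + e - r, ?_, by linarith, by linarith⟩
    have h : δ ∣ -k * m + e - r := by
      rw [hr, heq]; exact Int.dvd_self_sub_emod
    have heq' : N - k * m + e - r = N + (-k * m + e - r) := by ring
    exact heq' ▸ dvd_add hδN h
  · set T := N - k * m + e with hT
    have h0 := Int.emod_nonneg T hδ.ne'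
    have h1 := Int.emod_lt_of_pos T hδ
    refine ⟨T - T % δ, Int.dvd_self_sub_emod, ?_, by linarith⟩
    have h2 : (k + l) * (m + 1) ≤ (k + l) * M := mul_le_mul_of_nonneg_left hlt hkl.le
    linarith

theorem stmt14 (n : ℕ) [NeZero n] (k l p : ℕ) (hl : 1 ≤ l) (hkl : l < k)
    (hp : p.Prime) (hpn : p ∣ n) (hpkl : (p : ℤ) ∣ ((k : ℤ) - (l : ℤ)))
    (δ r : ℤ) (hδ : δ = Int.gcd (n : ℤ) ((k : ℤ) - (l : ℤ)))
    (hr : r = (-(k : ℤ) * (((n : ℤ) + 2 * ((p : ℤ) - 1)) / ((k : ℤ) + (l : ℤ)))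
        + ((p : ℤ) - 1)) % δ) :
    ((n : ℤ) + 2 * ((p : ℤ) - 1) - r) / ((k : ℤ) + (l : ℤ)) - ((p : ℤ) - 1)
        ≤ (mu n k l ({0, (p : ZMod n)} : Finset (ZMod n)) : ℤ) ∧
      (mu n k l ({0, (p : ZMod n)} : Finset (ZMod n)) : ℤ)
        ≤ (n : ℤ) / ((k : ℤ) + (l : ℤ)) := by
  have hδpos : 0 < δ := by
    rw [hδ]
    exact_mod_cast Int.gcd_pos_of_ne_zero_left _ (by exact_mod_cast NeZero.ne n)
  have hδle : δ ≤ (k : ℤ) + l := by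
    have := Int.le_of_dvd (by omega : (0 : ℤ) < (k : ℤ) - l)
      (hδ ▸ Int.gcd_dvd_right (n : ℤ) ((k : ℤ) - l))
    omega
  constructor
  · set m := ((n : ℤ) + 2 * ((p : ℤ) - 1) - r) / ((k : ℤ) + l) with hm
    rcases le_total (m - ((p : ℤ) - 1)) 0 with hs | hs
    · exact hs.trans (Int.natCast_nonneg _)
    obtain ⟨t, ⟨w, rfl⟩, hlo, hhi⟩ := exists_multiple_le_of_residue hδpos
      (hδ ▸ Int.gcd_dvd_left (n : ℤ) ((k : ℤ) - l)) hδle (by omega) hr hm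
    have hbez := Int.gcd_eq_gcd_ab (n : ℤ) ((k : ℤ) - l)
    rw [← hδ] at hbez
    set u := Int.gcdA (n : ℤ) ((k : ℤ) - l)
    set v := Int.gcdB (n : ℤ) ((k : ℤ) - l)
    have hfree := sumFree_image_Ico (n := n) (k := k) (l := l) (p := p) (a := v * w)
      (s := m - ((p : ℤ) - 1)) (t := δ * w) (by omega) hl
      ⟨-(u * w), by linear_combination -w * hbez⟩ (by linarith) (by linarith)
    have hsn : m - ((p : ℤ) - 1) ≤ n := by
      have hpn' : (p : ℤ) ≤ n := by exact_mod_cast Nat.le_of_dvd (NeZero.pos n) hpn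
      have hp1 : (1 : ℤ) ≤ p := by exact_mod_cast hp.one_le
      have hr0 : 0 ≤ r := hr ▸ Int.emod_nonneg _ hδpos.ne'
      have hmul : ((k : ℤ) + l) * m ≤ n + 2 * ((p : ℤ) - 1) - r :=
        Int.mul_ediv_self_le (by omega)
      have : 3 * m ≤ ((k : ℤ) + l) * m := mul_le_mul_of_nonneg_right (by omega) (by omega)
      linarith
    rw [← card_image_intCast_Ico (n := n) (a := v * w) hs hsn]
    exact_mod_cast hfree.card_le_mu
  · have h : mu n k l ({0, (p : ZMod n)} : Finset (ZMod n)) ≤ n / (k + l) := mu_le fun A hA => by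
      rw [Nat.le_div_iff_mul_le (by omega), mul_comm]
      exact hA.add_mul_card_le (by omega) hl hpkl
    exact_mod_cast h
end

section
/- Let n ≥ 1, let k > ℓ ≥ 1 be integers, let s ≥ 1 be an integer, and let e be a positive divisor of both s and n. Let ψ : ZMod n → ZMod e be the canonical ring projection. If B ⊆ ZMod e is (k,ℓ)-sum-free (i.e., kB ∩ ℓB = ∅), then A = ψ⁻¹(B) ⊆ ZMod n is {0,s}-(k,ℓ)-sum-free, where {0,s} is the image of {0, s} ⊆ ℤ in ZMod n; moreover |A| = |B| · (n/e). -/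
open Finset Pointwise

theorem map_mem_iterSum {n e : ℕ} (f : ZMod n →+ ZMod e) {A : Finset (ZMod n)}
    {B : Finset (ZMod e)} (h : ∀ a ∈ A, f a ∈ B) :
    ∀ {j : ℕ} {x : ZMod n}, x ∈ iterSum j A → f x ∈ iterSum j B
  | 0, x, hx => by
    rw [iterSum, Finset.mem_singleton] at hx ⊢
    rw [hx, map_zero]
  | j + 1, x, hx => by
    rw [iterSum, Finset.mem_add] at hx
    obtain ⟨a, ha, y, hy, rfl⟩ := hx
    rw [map_add, iterSum]
    exact Finset.add_mem_add (h a ha) (map_mem_iterSum f h hy)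

theorem iterSum_singleton_zero {n : ℕ} (j : ℕ) : iterSum j ({0} : Finset (ZMod n)) = {0} := by
  induction j with
  | zero => rfl
  | succ j ih => rw [iterSum, ih, Finset.singleton_add_singleton, add_zero]

theorem map_mem_iterSum_of_mem_noisy {n e : ℕ} (f : ZMod n →+ ZMod e) {A C : Finset (ZMod n)}
    {B : Finset (ZMod e)} (hA : ∀ a ∈ A, f a ∈ B) (hC : ∀ c ∈ C, f c = 0)
    {j : ℕ} {x : ZMod n} (hx : x ∈ noisy C j A) : f x ∈ iterSum j B := by
  rw [noisy, Finset.mem_add] at hx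
  obtain ⟨a, ha, c, hc, rfl⟩ := hx
  have hc' : f c ∈ iterSum (j - 1) {0} :=
    map_mem_iterSum f (fun c hc => Finset.mem_singleton.2 (hC c hc)) hc
  rw [iterSum_singleton_zero, Finset.mem_singleton] at hc'
  rw [map_add, hc', add_zero]
  exact map_mem_iterSum f hA ha

/-- Preimages under a surjective homomorphism of finite groups have proportional size. -/
theorem card_filter_map_mem_mul_card {G H : Type*} [AddGroup G] [AddGroup H] [Fintype G]
    [Fintype H] [DecidableEq H] (f : G →+ H) (hf : Function.Surjective f) (B : Finset H) :
    (Finset.univ.filter fun x => f x ∈ B).card * Fintype.card H = B.card * Fintype.card G := by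
  have hfiber (b : H) : (Finset.univ.filter fun x => f x = b).card =
      (Finset.univ.filter fun x => f x = 0).card :=
    AddMonoidHom.card_fiber_eq_of_mem_range f (hf b) (hf 0)
  have hcard (S : Finset H) : (Finset.univ.filter fun x => f x ∈ S).card =
      S.card * (Finset.univ.filter fun x => f x = 0).card := by
    rw [Finset.card_eq_sum_card_fiberwise (f := f) (t := S) (fun x hx => by simpa using hx),
      Finset.sum_const_nat]
    intro b hb
    rw [← hfiber b, Finset.filter_filter]
    congr 1
    ext x
    simp only [Finset.mem_filter, Finset.mem_univ, true_and, and_iff_right_iff_imp]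
    rintro rfl
    exact hb
  have huniv := hcard Finset.univ
  simp only [Finset.mem_univ, Finset.filter_true, Finset.card_univ] at huniv
  rw [hcard B, huniv]
  ring

theorem stmt15 (n : ℕ) [NeZero n] (k l s e : ℕ) (hl : 1 ≤ l) (hkl : l < k) (hs : 1 ≤ s)
    (he : 0 < e) (hes : e ∣ s) (hen : e ∣ n)
    (B : Finset (ZMod e)) (hB : iterSum k B ∩ iterSum l B = ∅)
    (A : Finset (ZMod n))
    (hA : A = Finset.univ.filter fun x => ZMod.castHom hen (ZMod e) x ∈ B) :
    SumFree ({0, (s : ZMod n)} : Finset (ZMod n)) k l A ∧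
      A.card = B.card * (n / e) := by
  have : NeZero e := ⟨he.ne'⟩
  let f : ZMod n →+ ZMod e := (ZMod.castHom hen (ZMod e)).toAddMonoidHom
  subst hA
  constructor
  · have hA : ∀ a ∈ Finset.univ.filter (fun x => ZMod.castHom hen (ZMod e) x ∈ B), f a ∈ B :=
      fun a ha => (Finset.mem_filter.1 ha).2
    have hC : ∀ c ∈ ({0, (s : ZMod n)} : Finset (ZMod n)), f c = 0 := by
      intro c hc
      rcases Finset.mem_insert.1 hc with rfl | hc
      · exact map_zero f
      · rw [Finset.mem_singleton.1 hc]
        exact (map_natCast (ZMod.castHom hen (ZMod e)) s).trans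
          ((ZMod.natCast_eq_zero_iff s e).2 hes)
    refine Finset.eq_empty_of_forall_notMem fun x hx => ?_
    rw [Finset.mem_inter] at hx
    have hfx : f x ∈ iterSum k B ∩ iterSum l B := Finset.mem_inter.2
      ⟨map_mem_iterSum_of_mem_noisy f hA hC hx.1, map_mem_iterSum_of_mem_noisy f hA hC hx.2⟩
    rw [hB] at hfx
    exact Finset.notMem_empty _ hfx
  · have h := card_filter_map_mem_mul_card f (ZMod.ringHom_surjective _) B
    rw [ZMod.card, ZMod.card] at h
    rw [← Nat.mul_div_assoc _ hen, ← h, Nat.mul_div_cancel _ he]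
    rfl
end
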